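/- Let f₁, f₂ : ℝⁿ → ℝ be convex functions, f = f₁ − f₂, and let x̄ ∈ ℝⁿ be a local minimizer of f. (i) If ∂_ε f₂(x̄) ⊆ ∂_ε f₁(x̄) for every ε ≥ 0, then x̄ is a global minimizer of f. (ii) If x̄ is not a global minimizer of f (i.e., there exists y with f(y) < f(x̄)), then there exists a global descent direction of f at x̄: a vector d ≠ 0 together with ᾱ > 0 and δ ∈ (0, ᾱ) such that f(x̄ + α d) < f(x̄) for all α ∈ (ᾱ − δ, ᾱ + δ). -/

import Mathlib

open scoped RealInnerProductSpace

/-- The ε-subdifferential of `g` at `x`. -/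
def epsSubdiff {n : ℕ} (g : EuclideanSpace ℝ (Fin n) → ℝ) (ε : ℝ)
    (x : EuclideanSpace ℝ (Fin n)) : Set (EuclideanSpace ℝ (Fin n)) :=
  {ξ | ∀ y, g y ≥ g x + ⟪ξ, y - x⟫ - ε}

/-- The subdifferential of `g` at `x`. -/
def subdiff {n : ℕ} (g : EuclideanSpace ℝ (Fin n) → ℝ)
    (x : EuclideanSpace ℝ (Fin n)) : Set (EuclideanSpace ℝ (Fin n)) :=
  {ξ | ∀ y, g y ≥ g x + ⟪ξ, y - x⟫}

/-- The t-spherical subdifferential of `g` at `x`. -/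
def sphSubdiff {n : ℕ} (g : EuclideanSpace ℝ (Fin n) → ℝ) (t : ℝ)
    (x : EuclideanSpace ℝ (Fin n)) : Set (EuclideanSpace ℝ (Fin n)) :=
  convexHull ℝ {ξ | ∃ d : EuclideanSpace ℝ (Fin n), ‖d‖ = 1 ∧ ξ ∈ subdiff g (x + t • d)}

theorem global_optimality_and_global_descent {n : ℕ}
    (f₁ f₂ f : EuclideanSpace ℝ (Fin n) → ℝ)
    (h₁ : ConvexOn ℝ Set.univ f₁) (h₂ : ConvexOn ℝ Set.univ f₂)
    (hf : ∀ x, f x = f₁ x - f₂ x)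
    (xbar : EuclideanSpace ℝ (Fin n))
    (hloc : ∃ U : Set (EuclideanSpace ℝ (Fin n)),
      IsOpen U ∧ xbar ∈ U ∧ ∀ y ∈ U, f xbar ≤ f y) :
    ((∀ ε : ℝ, 0 ≤ ε → epsSubdiff f₂ ε xbar ⊆ epsSubdiff f₁ ε xbar) →
      ∀ x, f xbar ≤ f x) ∧
    ((∃ y, f y < f xbar) →
      ∃ d : EuclideanSpace ℝ (Fin n), d ≠ 0 ∧
        ∃ αbar : ℝ, 0 < αbar ∧ ∃ δ : ℝ, 0 < δ ∧ δ < αbar ∧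
          ∀ α : ℝ, αbar - δ < α → α < αbar + δ → f (xbar + α • d) < f xbar) := by
  have c₁ : Continuous f₁ := h₁.locallyLipschitz.continuous
  have c₂ : Continuous f₂ := h₂.locallyLipschitz.continuous
  have cf : Continuous f := by
    have : f = fun x => f₁ x - f₂ x := funext hf
    rw [this]
    exact c₁.sub c₂
  constructor
  · intro h x
    refine le_of_forall_pos_le_add fun η hη => ?_
    obtain ⟨l, c, hle, heq⟩ := ConvexOn.exists_affine_le_of_lt (𝕜 := ℝ) (Set.mem_univ x)
      (show f₂ x - η < f₂ x by linarith) isClosed_univ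
      (c₂.lowerSemicontinuous.lowerSemicontinuousOn _) h₂
    have hle' : ∀ y, l y + c ≤ f₂ y := fun y => by simpa using hle ⟨y, Set.mem_univ y⟩
    have heq' : l x + c = f₂ x - η := by simpa using heq
    obtain ⟨ξ, hξ⟩ := (InnerProductSpace.toDual ℝ (EuclideanSpace ℝ (Fin n))).surjective l
    have hl : ∀ y, ⟪ξ, y⟫ = l y := fun y => by
      rw [← hξ, InnerProductSpace.toDual_apply_apply]
    have hmem : ξ ∈ epsSubdiff f₂ (f₂ xbar - (l xbar + c)) xbar := by
      intro y
      have := hle' y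
      rw [hl, map_sub]
      linarith
    have key := h _ (by linarith [hle' xbar]) hmem x
    rw [hl, map_sub] at key
    rw [hf, hf]
    linarith
  · rintro ⟨y, hy⟩
    have hne : y - xbar ≠ 0 := by
      intro h0
      rw [sub_eq_zero.mp h0] at hy
      exact lt_irrefl _ hy
    refine ⟨y - xbar, hne, 1, one_pos, ?_⟩
    have cg : Continuous fun α : ℝ => f (xbar + α • (y - xbar)) := by fun_prop
    have ho : IsOpen {α : ℝ | f (xbar + α • (y - xbar)) < f xbar} :=
      isOpen_lt cg continuous_const
    obtain ⟨r, hr, hball⟩ := Metric.isOpen_iff.mp ho 1 (by simpa using hy)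
    refine ⟨min r (1 / 2), by positivity, by
      linarith [min_le_right r (1 / 2)], fun α h1 h2 => ?_⟩
    apply hball
    rw [Metric.mem_ball, Real.dist_eq, abs_lt]
    have := min_le_left r (1 / 2)
    constructor <;> linarith
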